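/- Let A be an n×n real matrix. Then perm(A) = (1/πⁿ) · ∫_{[0,2π]ⁿ} ∏_{i=1}^n ( sin θ_i · ∑_{j=1}^n A_{i,j} sin θ_j ) dθ, where the integral is with respect to Lebesgue measure on the cube [0,2π]ⁿ ⊂ ℝⁿ. -/

import Mathlib

open MeasureTheory Real

lemma sineaux_one : ∫ x in Set.Icc (0:ℝ) (2*π), Real.sin x ^ 1 = 0 := by
  rw [integral_Icc_eq_integral_Ioc, ← intervalIntegral.integral_of_le (by positivity)]
  simp

lemma sineaux_two : ∫ x in Set.Icc (0:ℝ) (2*π), Real.sin x ^ 2 = π := by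
  rw [integral_Icc_eq_integral_Ioc, ← intervalIntegral.integral_of_le (by positivity),
    integral_sin_sq]
  simp

lemma sineaux_prod {n : ℕ} (m : Fin n → ℕ) :
    ∫ θ in (Set.univ.pi fun _ : Fin n => Set.Icc (0 : ℝ) (2 * π)),
      ∏ k, Real.sin (θ k) ^ m k = ∏ k, ∫ x in Set.Icc (0:ℝ) (2*π), Real.sin x ^ m k := by
  rw [volume_pi, Measure.restrict_pi_pi]
  exact integral_fintype_prod_eq_prod (fun k x => Real.sin x ^ m k)

lemma sineaux_expand {n : ℕ} (A : Matrix (Fin n) (Fin n) ℝ) (θ : Fin n → ℝ) :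
    ∏ i, Real.sin (θ i) * ∑ j, A i j * Real.sin (θ j) =
    ∑ f : Fin n → Fin n, (∏ i, A i (f i)) *
      ∏ k, Real.sin (θ k) ^ (1 + (Finset.univ.filter fun i => f i = k).card) := by
  rw [Finset.prod_mul_distrib, Finset.prod_univ_sum, Fintype.piFinset_univ, Finset.mul_sum]
  refine Finset.sum_congr rfl fun f _ => ?_
  have h : ∏ i, Real.sin (θ (f i)) =
      ∏ k, Real.sin (θ k) ^ (Finset.univ.filter fun i => f i = k).card := by
    rw [← Finset.prod_fiberwise Finset.univ f]
    refine Finset.prod_congr rfl fun k _ => ?_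
    rw [← Finset.prod_const]
    refine Finset.prod_congr rfl fun i hi => ?_
    rw [(Finset.mem_filter.1 hi).2]
  simp only [pow_add, pow_one, Finset.prod_mul_distrib, h]
  ring

/-- The permanent as a multiple integral over products of sine functions:
`perm(A) = (1/πⁿ) ∫_{[0,2π]ⁿ} ∏ i, sin θ i * ∑ j, A i j * sin θ j dθ`. -/
theorem permanent_eq_sine_integral
    {n : ℕ} (A : Matrix (Fin n) (Fin n) ℝ) :
    A.permanent =
      (1 / π ^ n) *
        ∫ θ in (Set.univ.pi fun _ : Fin n => Set.Icc (0 : ℝ) (2 * π)),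
          ∏ i, Real.sin (θ i) * ∑ j, A i j * Real.sin (θ j) := by
  simp only [sineaux_expand]
  rw [integral_finset_sum]
  · simp only [integral_const_mul, sineaux_prod]
    rw [Finset.mul_sum, ← Matrix.permanent_transpose, Matrix.permanent]
    refine Finset.sum_of_injOn (fun σ : Equiv.Perm (Fin n) => (σ : Fin n → Fin n)) ?_ ?_ ?_ ?_
    · intro a _ b _ h
      exact DFunLike.coe_injective h
    · intro a _
      simp
    · intro f _ hf
      have hs : ¬ Function.Surjective f := by
        intro hs
        apply hf
        exact ⟨Equiv.ofBijective f (Finite.surjective_iff_bijective.1 hs), by simp, rfl⟩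
      simp only [Function.Surjective, not_forall, not_exists] at hs
      obtain ⟨k, hk⟩ := hs
      have : ∏ k, ∫ x in Set.Icc (0:ℝ) (2*π),
          Real.sin x ^ (1 + (Finset.univ.filter fun i => f i = k).card) = 0 := by
        apply Finset.prod_eq_zero (Finset.mem_univ k)
        have : (Finset.univ.filter fun i => f i = k) = ∅ := by
          simp [Finset.filter_eq_empty_iff, hk]
        rw [this]
        exact sineaux_one
      rw [this]
      simp
    · intro σ _
      have : ∀ k, (Finset.univ.filter fun i => σ i = k).card = 1 := by
        intro k
        rw [Finset.card_eq_one]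
        refine ⟨σ.symm k, ?_⟩
        ext i
        simp [Equiv.eq_symm_apply]
      simp only [this, Nat.reduceAdd, sineaux_two, Finset.prod_const, Finset.card_univ,
        Fintype.card_fin, Matrix.transpose_apply]
      have := Real.pi_ne_zero
      field_simp
  · intro f _
    apply ContinuousOn.integrableOn_compact
    · exact isCompact_univ_pi fun _ => isCompact_Icc
    · fun_prop
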